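/- arXiv:math/0611214 — 7 statements merged into one kernel-verified Lean document; each statement's English description precedes it below -/
import Mathlib

section
/- Let Q=[A,B,C] be a real binary quadratic form with discriminant D=B²−4AC>0. Then for every z∈ℂ with Im z>0 one has Q'(z)≠0 and Im(Q(z)/Q'(z))>0, and for every z with Im z<0 one has Q'(z)≠0 and Im(Q(z)/Q'(z))<0; that is, φ(·,Q) maps the upper half-plane to itself and the lower half-plane to itself. -/
open Complex

noncomputable section

/-- A real binary quadratic form `Q = [A,B,C]`, as a triple of coefficients. -/
abbrev QF : Type := ℝ × ℝ × ℝ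

/-- The value `Q(z) = A z² + B z + C`. -/
def Qpoly (Q : QF) (z : ℂ) : ℂ := (Q.1 : ℂ) * z ^ 2 + (Q.2.1 : ℂ) * z + (Q.2.2 : ℂ)

/-- The derivative `Q'(z) = 2 A z + B`. -/
def Qderiv (Q : QF) (z : ℂ) : ℂ := 2 * (Q.1 : ℂ) * z + (Q.2.1 : ℂ)

/-- `φ(z,Q) = Q(z)/Q'(z)`. -/
def phiQ (Q : QF) (z : ℂ) : ℂ := Qpoly Q z / Qderiv Q z

theorem Qderiv_ne_zero {A B C : ℝ} (hD : 0 < B ^ 2 - 4 * A * C) {z : ℂ} (hz : z.im ≠ 0) :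
    Qderiv (A, B, C) z ≠ 0 := by
  intro h
  have hre := congrArg Complex.re h
  have him := congrArg Complex.im h
  simp [Qderiv, hz] at hre him
  subst him
  simp at hre
  simp [hre] at hD

theorem phiQ_im {A B C : ℝ} {z : ℂ} (h : Qderiv (A, B, C) z ≠ 0) :
    (phiQ (A, B, C) z).im =
      z.im * ((normSq (Qderiv (A, B, C) z) + (B ^ 2 - 4 * A * C)) /
        (2 * normSq (Qderiv (A, B, C) z))) := by
  have hn : normSq (Qderiv (A, B, C) z) ≠ 0 := normSq_eq_zero.not.mpr h
  rw [phiQ, div_im]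
  field_simp
  simp [Qpoly, Qderiv, normSq_apply, pow_two]
  ring

/-- For a real quadratic form `Q = [A,B,C]` with
discriminant `B² - 4AC > 0`, the map `φ(·,Q)` sends the upper half-plane
to itself and the lower half-plane to itself: for `Im z > 0` one has
`Q'(z) ≠ 0` and `Im φ(z,Q) > 0`, and for `Im z < 0` one has `Q'(z) ≠ 0`
and `Im φ(z,Q) < 0`. -/
theorem phi_preserves_halfplanes (A B C : ℝ) (hD : 0 < B ^ 2 - 4 * A * C) :
    (∀ z : ℂ, 0 < z.im →
      Qderiv (A, B, C) z ≠ 0 ∧ 0 < (phiQ (A, B, C) z).im) ∧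
    (∀ z : ℂ, z.im < 0 →
      Qderiv (A, B, C) z ≠ 0 ∧ (phiQ (A, B, C) z).im < 0) := by
  have key (z : ℂ) (hz : z.im ≠ 0) : 0 < (normSq (Qderiv (A, B, C) z) + (B ^ 2 - 4 * A * C)) /
      (2 * normSq (Qderiv (A, B, C) z)) := by
    have hn := normSq_pos.mpr (Qderiv_ne_zero hD hz)
    positivity
  refine ⟨fun z hz => ⟨Qderiv_ne_zero hD hz.ne', ?_⟩, fun z hz => ⟨Qderiv_ne_zero hD hz.ne, ?_⟩⟩
  · rw [phiQ_im (Qderiv_ne_zero hD hz.ne')]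
    exact mul_pos hz (key z hz.ne')
  · rw [phiQ_im (Qderiv_ne_zero hD hz.ne)]
    exact mul_neg_of_neg_of_pos hz (key z hz.ne)
end
end

section
/- Let Q=[A,B,C] be a real binary quadratic form with discriminant D=B²−4AC>0. If z lies on the circle C_Q (i.e. A|z|²+B·Re z+C=0) and Im z>0, then Q'(z)≠0 and φ(z,Q) = i·Im z. -/
open Complex

noncomputable section

/-- Let `Q = [A,B,C]` be a real quadratic form with
discriminant `B² - 4AC > 0`.  If `z` lies on the circle
`C_Q = {z : A|z|² + B·Re z + C = 0}` and `Im z > 0`, then `Q'(z) ≠ 0`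
and `φ(z,Q) = i·Im z`. -/
theorem phi_on_circle (A B C : ℝ) (hD : 0 < B ^ 2 - 4 * A * C)
    (z : ℂ) (hz : 0 < z.im)
    (hcirc : A * Complex.normSq z + B * z.re + C = 0) :
    Qderiv (A, B, C) z ≠ 0 ∧ phiQ (A, B, C) z = Complex.I * (z.im : ℂ) := by
  have hderiv : Qderiv (A, B, C) z ≠ 0 := by
    intro h
    have him := congrArg Complex.im h
    have hre := congrArg Complex.re h
    simp [Qderiv, hz.ne'] at him hre
    subst him
    simp at hre
    simp [hre] at hD
  refine ⟨hderiv, ?_⟩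
  rw [phiQ, div_eq_iff hderiv]
  rw [normSq_apply] at hcirc
  apply Complex.ext
  · simp [Qpoly, Qderiv, pow_two]
    linear_combination hcirc
  · simp [Qpoly, Qderiv, pow_two]
    ring
end
end

section
/- Let Q=[A,B,C] be a real binary quadratic form with discriminant D=B²−4AC>0, let z∈ℍ, and let s∈ℂ with Re s>1. Then the family indexed by coprime pairs (c,d)∈ℤ² whose terms are the complex powers (φ(z,Q)/((cz+d)·(c·(N_Q·z)+d)))^s (principal branch; each base lies in the upper half-plane, hence off the cut) is absolutely summable. -/
open Complex

noncomputable section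

/-- The Möbius action of the matrix `N_Q = [[-B,-2C],[2A,B]]` on `z`. -/
def NQmoeb (Q : QF) (z : ℂ) : ℂ :=
  (-(Q.2.1 : ℂ) * z - 2 * (Q.2.2 : ℂ)) / (2 * (Q.1 : ℂ) * z + (Q.2.1 : ℂ))

/-- If the discriminant is positive, then `N_Q` maps the upper to the lower half-plane. -/
theorem NQmoeb_im_neg (A B C : ℝ) (hD : 0 < B ^ 2 - 4 * A * C) (z : ℂ) (hz : 0 < z.im) :
    (NQmoeb (A, B, C) z).im < 0 := by
  have hne : 2 * (A : ℂ) * z + (B : ℂ) ≠ 0 := by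
    intro h
    have him : A = 0 := by simpa [hz.ne'] using congrArg Complex.im h
    have hre : B = 0 := by simpa [him] using congrArg Complex.re h
    simp [him, hre] at hD
  have hpos : 0 < normSq (2 * (A : ℂ) * z + (B : ℂ)) := normSq_pos.mpr hne
  have key : (NQmoeb (A, B, C) z).im =
      -((B ^ 2 - 4 * A * C) * z.im) / normSq (2 * (A : ℂ) * z + (B : ℂ)) := by
    simp only [NQmoeb, div_im, ← sub_div]
    congr 1
    simp
    ring
  rw [key]
  exact div_neg_of_neg_of_pos (neg_neg_of_pos (mul_pos hD hz)) hpos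

/-- The norm of a linear form with integer coefficients is the same at `w` and its conjugate. -/
theorem norm_intCast_mul_conj_add (c d : ℤ) (w : ℂ) :
    ‖(c : ℂ) * (starRingEnd ℂ) w + d‖ = ‖(c : ℂ) * w + d‖ := by
  rw [← Complex.norm_conj ((c : ℂ) * w + d)]
  simp

/-- A complex power is bounded by the real power of the norm, uniformly in the argument. -/
theorem norm_cpow_le_mul_exp (w s : ℂ) :
    ‖w ^ s‖ ≤ Real.exp (Real.pi * |s.im|) * ‖w‖ ^ s.re := by
  refine (norm_cpow_le w s).trans ?_
  rw [div_eq_mul_inv, ← Real.exp_neg, mul_comm]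
  gcongr
  calc -(arg w * s.im) ≤ |arg w * s.im| := neg_le_abs _
    _ = |arg w| * |s.im| := abs_mul _ _
    _ ≤ Real.pi * |s.im| := by
      gcongr
      exact abs_arg_le_pi w

/-- Lattice sum of products of two linear forms, at points of the upper half-plane. -/
theorem summable_norm_rpow_mul_norm_rpow (z w : UpperHalfPlane) {k : ℝ} (hk : 1 < k) :
    Summable fun x : Fin 2 → ℤ =>
      ‖(x 0 : ℂ) * z + x 1‖ ^ (-k) * ‖(x 0 : ℂ) * w + x 1‖ ^ (-k) := by
  have hsum := (EisensteinSeries.summable_one_div_norm_rpow (k := k + k) (by linarith)).mul_left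
    (EisensteinSeries.r z ^ (-k) * EisensteinSeries.r w ^ (-k))
  refine hsum.of_nonneg_of_le (fun x => by positivity) fun x => ?_
  have hk0 : 0 ≤ k := by linarith
  calc _ ≤ (EisensteinSeries.r z ^ (-k) * ‖x‖ ^ (-k)) *
        (EisensteinSeries.r w ^ (-k) * ‖x‖ ^ (-k)) := by
        have := (EisensteinSeries.r_pos z).le
        gcongr
        · exact EisensteinSeries.summand_bound z hk0 x
        · exact EisensteinSeries.summand_bound w hk0 x
    _ = _ := by
        rw [neg_add, Real.rpow_add' (norm_nonneg x) (by linarith)]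
        ring

/-- Let `Q = [A,B,C]` have discriminant `B² - 4AC > 0`, let
`z ∈ ℍ` and let `s ∈ ℂ` with `Re s > 1`.  The family, indexed by coprime
pairs `(c,d) ∈ ℤ²`, of principal-branch complex powers
`(φ(z,Q)/((cz+d)(c(N_Q·z)+d)))^s` is absolutely summable. -/
theorem summable_eisenstein_lift (A B C : ℝ) (hD : 0 < B ^ 2 - 4 * A * C)
    (z : ℂ) (hz : 0 < z.im) (s : ℂ) (hs : 1 < s.re) :
    Summable fun p : {p : ℤ × ℤ // IsCoprime p.1 p.2} =>
      ‖(phiQ (A, B, C) z /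
          (((p.1.1 : ℂ) * z + (p.1.2 : ℂ)) *
            ((p.1.1 : ℂ) * NQmoeb (A, B, C) z + (p.1.2 : ℂ)))) ^ s‖ := by
  have hw : 0 < ((starRingEnd ℂ) (NQmoeb (A, B, C) z)).im := by
    simpa using NQmoeb_im_neg A B C hD z hz
  have hsum := (summable_norm_rpow_mul_norm_rpow ⟨z, hz⟩ ⟨_, hw⟩ hs).comp_injective
    ((finTwoArrowEquiv ℤ).symm.injective.comp
      (Subtype.val_injective (p := fun p : ℤ × ℤ => IsCoprime p.1 p.2)))
  refine (hsum.mul_left (Real.exp (Real.pi * |s.im|) *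
    ‖phiQ (A, B, C) z‖ ^ s.re)).of_nonneg_of_le (fun p => norm_nonneg _) fun p => ?_
  refine (norm_cpow_le_mul_exp _ s).trans_eq ?_
  simp only [Function.comp_apply, finTwoArrowEquiv_symm_apply, Matrix.cons_val_zero,
    Matrix.cons_val_one, norm_intCast_mul_conj_add]
  rw [norm_div, norm_mul, Real.div_rpow (by positivity) (by positivity),
    Real.mul_rpow (by positivity) (by positivity), Real.rpow_neg (by positivity),
    Real.rpow_neg (by positivity)]
  ring
end
end

section
/- Let Q=[A,B,C] be a real binary quadratic form with discriminant D=B²−4AC>0 and let Ψ be as in the context. If γ∈SL(2,ℤ) satisfies γQ=Q, then Int(Q,γ;z₀) does not depend on the base point: Int(Q,γ;z₀)=Int(Q,γ;z₁) for all z₀,z₁∈ℍ. -/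
open Complex

noncomputable section

/-- Discriminant `D = B² - 4AC`. -/
def disc (Q : QF) : ℝ := Q.2.1 ^ 2 - 4 * Q.1 * Q.2.2

/-- The right action `Q|g` of `g = [[a,b],[c,d]]` on forms:
`(Q|g)(x,y) = Q(ax+by, cx+dy)`. -/
def Qslash (Q : QF) (a b c d : ℝ) : QF :=
  (Q.1 * a ^ 2 + Q.2.1 * a * c + Q.2.2 * c ^ 2,
   2 * Q.1 * a * b + Q.2.1 * (a * d + b * c) + 2 * Q.2.2 * c * d,
   Q.1 * b ^ 2 + Q.2.1 * b * d + Q.2.2 * d ^ 2)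

abbrev SL2Z := Matrix.SpecialLinearGroup (Fin 2) ℤ

/-- `Q|g` for an integral matrix `g ∈ SL(2,ℤ)`. -/
def QslashZ (Q : QF) (g : SL2Z) : QF :=
  Qslash Q ((g.1 0 0 : ℤ) : ℝ) ((g.1 0 1 : ℤ) : ℝ) ((g.1 1 0 : ℤ) : ℝ) ((g.1 1 1 : ℤ) : ℝ)

/-- The left action `gQ := Q|g⁻¹`. -/
def QAct (g : SL2Z) (Q : QF) : QF := QslashZ Q g⁻¹

/-- The Möbius action `g·z = (az+b)/(cz+d)` of `g ∈ SL(2,ℤ)` on `z ∈ ℂ`. -/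
def moebZ (g : SL2Z) (z : ℂ) : ℂ :=
  (((g.1 0 0 : ℤ) : ℂ) * z + ((g.1 0 1 : ℤ) : ℂ)) /
    (((g.1 1 0 : ℤ) : ℂ) * z + ((g.1 1 1 : ℤ) : ℂ))

/-- The hyperbolic period `Int(Q,γ;z₀) = ∫_{z₀}^{γz₀} Ψ(z,Q) dz/Q(z)`, the
integral being taken over the straight segment `σ(t) = z₀ + t(γz₀ − z₀)`,
`t ∈ [0,1]` (legitimate since `Q` has only real zeros and `ℍ` is convex). -/
def IntQ (Ψ : QF → ℂ → ℂ) (Q : QF) (γ : SL2Z) (z₀ : ℂ) : ℂ :=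
  ∫ t in (0:ℝ)..1,
    Ψ Q (z₀ + (t : ℂ) * (moebZ γ z₀ - z₀)) * (moebZ γ z₀ - z₀) /
      Qpoly Q (z₀ + (t : ℂ) * (moebZ γ z₀ - z₀))

lemma Qpoly_ne_zero {Q : QF} (hD : 0 < disc Q) {z : ℂ} (hz : 0 < z.im) : Qpoly Q z ≠ 0 := by
  obtain ⟨A, B, C⟩ := Q
  intro h
  have hre := congrArg Complex.re h
  have him := congrArg Complex.im h
  simp only [Qpoly, pow_two, add_re, add_im, mul_re, mul_im, ofReal_re, ofReal_im, zero_re,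
    zero_im] at hre him
  simp only [disc] at hD
  have hlin : 2 * A * z.re + B = 0 := by
    apply (mul_eq_zero.mp (_ : (2 * A * z.re + B) * z.im = 0)).resolve_right hz.ne'
    linear_combination him
  have hdisc : B ^ 2 - 4 * A * C = -(2 * A * z.im) ^ 2 := by
    linear_combination (2 * A * z.re + B) * hlin - 4 * A * hre
  nlinarith [sq_nonneg (2 * A * z.im)]

lemma differentiable_Qpoly (Q : QF) : Differentiable ℂ (Qpoly Q) := by
  unfold Qpoly
  fun_prop

lemma moebZ_det (g : SL2Z) :
    ((g.1 0 0 : ℤ) : ℂ) * ((g.1 1 1 : ℤ) : ℂ) - ((g.1 0 1 : ℤ) : ℂ) * ((g.1 1 0 : ℤ) : ℂ) = 1 := by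
  have h := g.2
  rw [Matrix.det_fin_two] at h
  exact_mod_cast h

lemma moebZ_denom_ne_zero (g : SL2Z) {z : ℂ} (hz : 0 < z.im) :
    ((g.1 1 0 : ℤ) : ℂ) * z + ((g.1 1 1 : ℤ) : ℂ) ≠ 0 := by
  intro h
  have him := congrArg Complex.im h
  have hc : ((g.1 1 0 : ℤ) : ℂ) = 0 := by
    simpa [hz.ne'] using him
  have hd : ((g.1 1 1 : ℤ) : ℂ) = 0 := by simpa [hc] using h
  simpa [hc, hd] using moebZ_det g

lemma moebZ_im_pos (g : SL2Z) {z : ℂ} (hz : 0 < z.im) : 0 < (moebZ g z).im := by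
  have hdet : ((g.1 0 0 : ℤ) : ℝ) * ((g.1 1 1 : ℤ) : ℝ)
      - ((g.1 0 1 : ℤ) : ℝ) * ((g.1 1 0 : ℤ) : ℝ) = 1 := by exact_mod_cast moebZ_det g
  have hpos := Complex.normSq_pos.mpr (moebZ_denom_ne_zero g hz)
  have him : (moebZ g z).im
      = z.im / Complex.normSq (((g.1 1 0 : ℤ) : ℂ) * z + ((g.1 1 1 : ℤ) : ℂ)) := by
    rw [moebZ, Complex.div_im, ← sub_div]
    congr 1
    simp only [add_re, add_im, mul_re, mul_im, intCast_re, intCast_im]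
    linear_combination z.im * hdet
  rw [him]
  positivity

lemma hasDerivAt_moebZ (g : SL2Z) {z : ℂ} (hz : 0 < z.im) :
    HasDerivAt (moebZ g) (1 / (((g.1 1 0 : ℤ) : ℂ) * z + ((g.1 1 1 : ℤ) : ℂ)) ^ 2) z := by
  have hnum := ((hasDerivAt_id z).const_mul ((g.1 0 0 : ℤ) : ℂ)).add_const ((g.1 0 1 : ℤ) : ℂ)
  have hden := ((hasDerivAt_id z).const_mul ((g.1 1 0 : ℤ) : ℂ)).add_const ((g.1 1 1 : ℤ) : ℂ)
  refine (hnum.div hden (moebZ_denom_ne_zero g hz)).congr_deriv ?_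
  simp only [id]
  congr 1
  linear_combination moebZ_det g

lemma Qpoly_QAct_moebZ (Q : QF) (g : SL2Z) {z : ℂ} (hz : 0 < z.im) :
    Qpoly (QAct g Q) (moebZ g z)
      = Qpoly Q z / (((g.1 1 0 : ℤ) : ℂ) * z + ((g.1 1 1 : ℤ) : ℂ)) ^ 2 := by
  have hden := moebZ_denom_ne_zero g hz
  have hdet := moebZ_det g
  rw [eq_div_iff (pow_ne_zero 2 hden)]
  obtain ⟨A, B, C⟩ := Q
  simp only [Qpoly, QAct, QslashZ, Qslash, moebZ, Matrix.SpecialLinearGroup.SL2_inv_expl,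
    Matrix.cons_val', Matrix.cons_val_zero, Matrix.cons_val_one, Matrix.cons_val_fin_one]
  push_cast
  generalize ((g.1 0 0 : ℤ) : ℂ) = a at *
  generalize ((g.1 0 1 : ℤ) : ℂ) = b at *
  generalize ((g.1 1 0 : ℤ) : ℂ) = c at *
  generalize ((g.1 1 1 : ℤ) : ℂ) = d at *
  field_simp
  linear_combination (A * z ^ 2 + B * z + C) * (a * d - b * c + 1) * hdet

lemma convex_upperHalfPlane : Convex ℝ {z : ℂ | 0 < z.im} :=
  convex_halfSpace_im_gt 0

lemma segment_im_pos {z w : ℂ} (hz : 0 < z.im) (hw : 0 < w.im) {t : ℝ}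
    (ht : t ∈ Set.Icc (0 : ℝ) 1) : 0 < (z + (t : ℂ) * (w - z)).im := by
  simpa using convex_upperHalfPlane.add_smul_sub_mem hz hw ht

lemma integral_segment_eq_sub {f F : ℂ → ℂ} (hf : ContinuousOn f {z : ℂ | 0 < z.im})
    (hF : ∀ z : ℂ, 0 < z.im → HasDerivAt F (f z) z) {z w : ℂ} (hz : 0 < z.im) (hw : 0 < w.im) :
    ∫ t in (0 : ℝ)..1, f (z + (t : ℂ) * (w - z)) * (w - z) = F w - F z := by
  have hpath : ∀ t : ℝ, HasDerivAt (fun t : ℝ => z + (t : ℂ) * (w - z)) (w - z) t := fun t => by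
    simpa using ((hasDerivAt_id t).ofReal_comp.mul_const (w - z)).const_add z
  rw [intervalIntegral.integral_eq_sub_of_hasDerivAt
    (f := fun t : ℝ => F (z + (t : ℂ) * (w - z)))]
  · simp
  · intro t ht
    rw [Set.uIcc_of_le zero_le_one] at ht
    exact (hF _ (segment_im_pos hz hw ht)).comp t (hpath t)
  · apply ContinuousOn.intervalIntegrable
    rw [Set.uIcc_of_le zero_le_one]
    refine ContinuousOn.mul (hf.comp ?_ fun t ht => segment_im_pos hz hw ht) continuousOn_const
    fun_prop

/-- Let `Ψ` assign to every real quadratic form of positive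
discriminant a holomorphic function on `ℍ` with `Ψ(g·z, gQ) = Ψ(z,Q)` for all
`g ∈ SL(2,ℤ)`.  If `Q` has positive discriminant and `γ ∈ SL(2,ℤ)` satisfies
`γQ = Q`, then the hyperbolic period `Int(Q,γ;z₀)` does not depend on the base
point `z₀ ∈ ℍ`. -/
theorem IntQ_independent_of_basepoint (Ψ : QF → ℂ → ℂ)
    (hΨhol : ∀ Q : QF, 0 < disc Q →
      DifferentiableOn ℂ (Ψ Q) {z : ℂ | 0 < z.im})
    (hΨinv : ∀ Q : QF, 0 < disc Q → ∀ g : SL2Z, ∀ z : ℂ, 0 < z.im →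
      Ψ (QAct g Q) (moebZ g z) = Ψ Q z)
    (Q : QF) (hD : 0 < disc Q) (γ : SL2Z) (hγ : QAct γ Q = Q)
    (z₀ z₁ : ℂ) (h₀ : 0 < z₀.im) (h₁ : 0 < z₁.im) :
    IntQ Ψ Q γ z₀ = IntQ Ψ Q γ z₁ := by
  have hopen : IsOpen {z : ℂ | 0 < z.im} := isOpen_lt continuous_const continuous_im
  set f : ℂ → ℂ := fun z => Ψ Q z / Qpoly Q z with hf
  have hfdiff : DifferentiableOn ℂ f {z : ℂ | 0 < z.im} :=
    (hΨhol Q hD).div (differentiable_Qpoly Q).differentiableOn fun _ hz => Qpoly_ne_zero hD hz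
  obtain ⟨F, hF⟩ := convex_upperHalfPlane.exists_forall_hasDerivWithinAt hfdiff
  replace hF : ∀ z : ℂ, 0 < z.im → HasDerivAt F (f z) z := fun z hz =>
    (hF z hz).hasDerivAt (hopen.mem_nhds hz)
  have hInt : ∀ z : ℂ, 0 < z.im → IntQ Ψ Q γ z = F (moebZ γ z) - F z := fun z hz => by
    rw [← integral_segment_eq_sub hfdiff.continuousOn hF hz (moebZ_im_pos γ hz)]
    simp only [IntQ, hf, div_mul_eq_mul_div]
  have hderiv : ∀ z : ℂ, 0 < z.im → HasDerivAt (fun z => F (moebZ γ z) - F z) 0 z := fun z hz => by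
    refine (((hF _ (moebZ_im_pos γ hz)).comp z (hasDerivAt_moebZ γ hz)).sub
      (hF z hz)).congr_deriv ?_
    have hΨ := hΨinv Q hD γ z hz
    have hQ := Qpoly_QAct_moebZ Q γ hz
    rw [hγ] at hΨ hQ
    have hden := moebZ_denom_ne_zero γ hz
    have hne := Qpoly_ne_zero hD hz
    simp only [hf, hΨ, hQ]
    field_simp
    ring
  rw [hInt z₀ h₀, hInt z₁ h₁]
  exact hopen.is_const_of_deriv_eq_zero convex_upperHalfPlane.isPreconnected
    (fun z hz => (hderiv z hz).differentiableAt.differentiableWithinAt)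
    (fun z hz => (hderiv z hz).deriv) h₀ h₁
end
end

section
/- Let Q=[A,B,C] be a real binary quadratic form with A>0 whose roots x,x' satisfy 0<x'<x, so Q(z)=A(z−x)(z−x') and √D = A(x−x') where D=B²−4AC. Then the improper integral ∫₀^∞ i/Q(it) dt converges and −√D·∫₀^∞ i/Q(it) dt = log(x/x'), where log is the real logarithm. -/
open Complex

noncomputable section

theorem Qpoly_I_mul_eq (A x x' t : ℝ) :
    Qpoly (A, -A * (x + x'), A * x * x') (I * (t : ℂ)) = A * ((x - I * t) * (x' - I * t)) := by
  simp only [Qpoly]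
  push_cast
  ring

theorem ofReal_sub_I_mul_ne_zero {x : ℝ} (hx : 0 < x) (t : ℝ) : (x : ℂ) - I * t ≠ 0 := by
  intro h
  have h' := congrArg Complex.re h
  simp at h'
  exact hx.ne' h'

theorem norm_ofReal_sub_I_mul (x t : ℝ) : ‖(x : ℂ) - I * t‖ = √(x ^ 2 + t ^ 2) := by
  rw [Complex.norm_def, Complex.normSq_apply]
  congr 1
  simp
  ring

theorem le_norm_mul_ofReal_sub_I_mul {x x' : ℝ} (hx' : 0 < x') (hxx : x' < x) (t : ℝ) :
    x' ^ 2 + t ^ 2 ≤ ‖((x : ℂ) - I * t) * (x' - I * t)‖ := by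
  rw [norm_mul, norm_ofReal_sub_I_mul, norm_ofReal_sub_I_mul]
  calc x' ^ 2 + t ^ 2 = √(x' ^ 2 + t ^ 2) * √(x' ^ 2 + t ^ 2) :=
        (Real.mul_self_sqrt (by positivity)).symm
    _ ≤ √(x ^ 2 + t ^ 2) * √(x' ^ 2 + t ^ 2) := by gcongr

theorem integrable_I_div_mul_ofReal_sub_I_mul {A x x' : ℝ} (hA : 0 < A) (hx' : 0 < x')
    (hxx : x' < x) :
    MeasureTheory.Integrable
      (fun t : ℝ => I / ((A : ℂ) * (((x : ℂ) - I * t) * (x' - I * t)))) := by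
  have hm : 0 < min 1 (x' ^ 2) := lt_min one_pos (by positivity)
  refine (integrable_inv_one_add_sq.const_mul (A * min 1 (x' ^ 2))⁻¹).mono'
    (Continuous.aestronglyMeasurable ?_) (.of_forall fun t => ?_)
  · refine Continuous.div (by fun_prop) (by fun_prop) fun t => ?_
    exact mul_ne_zero (ofReal_ne_zero.2 hA.ne')
      (mul_ne_zero (ofReal_sub_I_mul_ne_zero (hx'.trans hxx) t) (ofReal_sub_I_mul_ne_zero hx' t))
  · rw [norm_div, norm_I, one_div, ← mul_inv, norm_mul, norm_real, Real.norm_of_nonneg hA.le,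
      mul_assoc]
    have hle : min 1 (x' ^ 2) * (1 + t ^ 2) ≤ x' ^ 2 + t ^ 2 := by
      nlinarith [min_le_left 1 (x' ^ 2), min_le_right 1 (x' ^ 2), sq_nonneg t]
    gcongr
    exact hle.trans (le_norm_mul_ofReal_sub_I_mul hx' hxx t)

theorem ofReal_sub_I_mul_div_mem_slitPlane {x x' : ℝ} (hx : 0 < x) (hx' : 0 < x') (t : ℝ) :
    ((x : ℂ) - I * t) / (x' - I * t) ∈ slitPlane := by
  refine Or.inl ?_
  have hn : 0 < normSq ((x' : ℂ) - I * t) := normSq_pos.2 (ofReal_sub_I_mul_ne_zero hx' t)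
  rw [div_re, ← add_div]
  refine div_pos ?_ hn
  simp
  nlinarith [mul_pos hx hx', mul_self_nonneg t]

theorem hasDerivAt_log_ofReal_sub_I_mul_div {x x' : ℝ} (hx : 0 < x) (hx' : 0 < x') (t : ℝ) :
    HasDerivAt (fun t : ℝ => log (((x : ℂ) - I * t) / (x' - I * t)))
      ((x - x') * (I / (((x : ℂ) - I * t) * (x' - I * t)))) t := by
  have hlin (y : ℝ) : HasDerivAt (fun t : ℝ => (y : ℂ) - I * t) (-I) t := by
    simpa using ((hasDerivAt_id t).ofReal_comp.const_mul I).const_sub (y : ℂ)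
  have h := ofReal_sub_I_mul_ne_zero hx t
  have h' := ofReal_sub_I_mul_ne_zero hx' t
  have hdiv : HasDerivAt (fun t : ℝ => ((x : ℂ) - I * t) / (x' - I * t)) _ t :=
    (hlin x).div (hlin x') h'
  convert hdiv.clog_real (ofReal_sub_I_mul_div_mem_slitPlane hx hx' t) using 1
  field_simp
  ring

theorem tendsto_log_ofReal_sub_I_mul_div {x' : ℝ} (x : ℝ) (hx' : 0 < x') :
    Filter.Tendsto (fun t : ℝ => log (((x : ℂ) - I * t) / (x' - I * t)))
      Filter.atTop (nhds 0) := by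
  have hnorm : Filter.Tendsto (fun t : ℝ => ‖(x' : ℂ) - I * t‖) Filter.atTop Filter.atTop := by
    refine Filter.tendsto_atTop_mono (fun t => ?_) Filter.tendsto_id
    rw [norm_ofReal_sub_I_mul]
    exact Real.le_sqrt_of_sq_le (by simp [sq_nonneg])
  have hinv : Filter.Tendsto (fun t : ℝ => ((x' : ℂ) - I * t)⁻¹) Filter.atTop (nhds 0) :=
    Filter.tendsto_inv₀_cobounded.comp (tendsto_norm_atTop_iff_cobounded.1 hnorm)
  have hratio : Filter.Tendsto (fun t : ℝ => ((x : ℂ) - I * t) / (x' - I * t))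
      Filter.atTop (nhds 1) := by
    have := (hinv.const_mul ((x : ℂ) - x')).const_add 1
    rw [mul_zero, add_zero] at this
    refine this.congr fun t => ?_
    have h' := ofReal_sub_I_mul_ne_zero hx' t
    field_simp
    ring
  simpa using hratio.clog one_mem_slitPlane

/-- Let `Q = [A,B,C]` with `A > 0` and roots `0 < x' < x`,
so that `Q(z) = A(z−x)(z−x')` and `√D = A(x−x')` with `D = B² − 4AC`.  Then
the improper integral `∫₀^∞ i/Q(it) dt` (along the positive imaginary axis)
converges and `−√D·∫₀^∞ i/Q(it) dt = log(x/x')`. -/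
theorem integral_along_imaginary_axis (A B C x x' : ℝ)
    (hA : 0 < A) (hx' : 0 < x') (hxx : x' < x)
    (hB : B = -A * (x + x')) (hC : C = A * x * x') :
    MeasureTheory.IntegrableOn
        (fun t : ℝ => Complex.I / Qpoly (A, B, C) (Complex.I * (t : ℂ)))
        (Set.Ioi 0) ∧
      -((Real.sqrt (B ^ 2 - 4 * A * C) : ℝ) : ℂ) *
          ∫ t in Set.Ioi (0:ℝ), Complex.I / Qpoly (A, B, C) (Complex.I * (t : ℂ)) =
        ((Real.log (x / x') : ℝ) : ℂ) := by
  subst hB hC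
  have hx : 0 < x := hx'.trans hxx
  have hsqrt : √((-A * (x + x')) ^ 2 - 4 * A * (A * x * x')) = A * (x - x') := by
    rw [show (-A * (x + x')) ^ 2 - 4 * A * (A * x * x') = (A * (x - x')) ^ 2 by ring]
    exact Real.sqrt_sq (mul_nonneg hA.le (sub_nonneg.2 hxx.le))
  simp only [Qpoly_I_mul_eq, hsqrt]
  have hint := (integrable_I_div_mul_ofReal_sub_I_mul hA hx' hxx).integrableOn (s := Set.Ioi 0)
  refine ⟨hint, ?_⟩
  have hderiv (t : ℝ) : HasDerivAt (fun t : ℝ => log (((x : ℂ) - I * t) / (x' - I * t)))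
      (((A * (x - x') : ℝ) : ℂ) * (I / ((A : ℂ) * (((x : ℂ) - I * t) * (x' - I * t))))) t := by
    convert hasDerivAt_log_ofReal_sub_I_mul_div hx hx' t using 1
    have hA' : (A : ℂ) ≠ 0 := ofReal_ne_zero.2 hA.ne'
    have h := ofReal_sub_I_mul_ne_zero hx t
    have h' := ofReal_sub_I_mul_ne_zero hx' t
    push_cast
    field_simp
  have hftc := MeasureTheory.integral_Ioi_of_hasDerivAt_of_tendsto' (fun t _ => hderiv t)
    (hint.const_mul _) (tendsto_log_ofReal_sub_I_mul_div x hx')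
  rw [MeasureTheory.integral_const_mul] at hftc
  rw [neg_mul, hftc, ofReal_log (div_pos hx hx').le]
  simp
end
end

section
/- Let Q=[A,B,C] be a real binary quadratic form with A≠0 and discriminant D=B²−4AC>0. A matrix g∈SL(2,ℝ) satisfies gQ=Q (equivalently Q|g=Q) if and only if there exists t∈ℝ such that g = M_t or g = −M_t, where M_t := cosh(t/2)·I + (sinh(t/2)/√D)·N_Q. -/
noncomputable section

/-- The matrix `N_Q = [[-B,-2C],[2A,B]]`. -/
def NQ (Q : QF) : Matrix (Fin 2) (Fin 2) ℝ :=
  !![-Q.2.1, -2 * Q.2.2; 2 * Q.1, Q.2.1]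

/-- The one-parameter family `M_t = cosh(t/2)·I + (sinh(t/2)/√D)·N_Q`. -/
def Mt (Q : QF) (t : ℝ) : Matrix (Fin 2) (Fin 2) ℝ :=
  Real.cosh (t / 2) • (1 : Matrix (Fin 2) (Fin 2) ℝ) +
    (Real.sinh (t / 2) / Real.sqrt (Q.2.1 ^ 2 - 4 * Q.1 * Q.2.2)) • NQ Q

theorem Mt_eq (A B C t v : ℝ) (hD : 0 < B ^ 2 - 4 * A * C)
    (hv : Real.sinh (t / 2) = v * √(B ^ 2 - 4 * A * C)) :
    Mt (A, B, C) t = !![Real.cosh (t / 2) - B * v, -2 * C * v;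
      2 * A * v, Real.cosh (t / 2) + B * v] := by
  have hs : √(B ^ 2 - 4 * A * C) ≠ 0 := (Real.sqrt_pos.2 hD).ne'
  have hq : Real.sinh (t / 2) / √(B ^ 2 - 4 * A * C) = v := by rw [hv, mul_div_cancel_right₀ _ hs]
  ext i j
  fin_cases i <;> fin_cases j <;> simp [Mt, NQ, hq] <;> ring

/-- The points of the hyperbola `u² - Dv² = 1` with `u > 0` parametrize the matrices `M_t`. -/
theorem exists_Mt_eq {A B C u v : ℝ} (hD : 0 < B ^ 2 - 4 * A * C)
    (huv : u ^ 2 - (B ^ 2 - 4 * A * C) * v ^ 2 = 1) (hu : 0 < u) :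
    ∃ t : ℝ, Mt (A, B, C) t = !![u - B * v, -2 * C * v; 2 * A * v, u + B * v] := by
  refine ⟨2 * Real.arsinh (v * √(B ^ 2 - 4 * A * C)), ?_⟩
  rw [Mt_eq A B C _ v hD (by rw [mul_div_cancel_left₀ _ two_ne_zero, Real.sinh_arsinh]),
    mul_div_cancel_left₀ _ two_ne_zero, Real.cosh_arsinh, mul_pow, Real.sq_sqrt hD.le,
    show 1 + v ^ 2 * (B ^ 2 - 4 * A * C) = u ^ 2 by linear_combination -huv,
    Real.sqrt_sq hu.le]

theorem Qslash_neg (Q : QF) (a b c d : ℝ) : Qslash Q (-a) (-b) (-c) (-d) = Qslash Q a b c d := by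
  simp [Qslash]

theorem Qslash_Mt (A B C t : ℝ) (hD : 0 < B ^ 2 - 4 * A * C) :
    Qslash (A, B, C) (Mt (A, B, C) t 0 0) (Mt (A, B, C) t 0 1) (Mt (A, B, C) t 1 0)
      (Mt (A, B, C) t 1 1) = (A, B, C) := by
  have hs := (Real.sqrt_pos.2 hD).ne'
  obtain ⟨v, hv⟩ : ∃ v, Real.sinh (t / 2) = v * √(B ^ 2 - 4 * A * C) :=
    ⟨_, (div_mul_cancel₀ _ hs).symm⟩
  have h := Real.cosh_sq (t / 2)
  rw [hv, mul_pow, Real.sq_sqrt hD.le] at h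
  rw [Mt_eq A B C t v hD hv]
  simp only [Qslash, Matrix.of_apply, Matrix.cons_val_zero, Matrix.cons_val_one, Prod.mk.injEq,
    Matrix.cons_val', Matrix.cons_val_fin_one]
  refine ⟨?_, ?_, ?_⟩
  · linear_combination A * h
  · linear_combination B * h
  · linear_combination C * h

/-- Let `Q = [A,B,C]` be a real quadratic form with `A ≠ 0`
and discriminant `D = B² − 4AC > 0`.  A matrix `g ∈ SL(2,ℝ)` satisfies
`gQ = Q` (equivalently `Q|g = Q`) if and only if `g = ±M_t` for some `t ∈ ℝ`,
where `M_t = cosh(t/2)·I + (sinh(t/2)/√D)·N_Q`. -/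
theorem stabilizer_iff_Mt (A B C : ℝ) (hA : A ≠ 0) (hD : 0 < B ^ 2 - 4 * A * C)
    (g : Matrix (Fin 2) (Fin 2) ℝ) (hg : g.det = 1) :
    Qslash (A, B, C) (g 0 0) (g 0 1) (g 1 0) (g 1 1) = (A, B, C) ↔
      ∃ t : ℝ, g = Mt (A, B, C) t ∨ g = -Mt (A, B, C) t := by
  rw [Matrix.det_fin_two] at hg
  constructor
  · intro h
    simp only [Qslash, Prod.mk.injEq] at h
    obtain ⟨h₁, h₂, h₃⟩ := h
    have e₁ : A * (g 1 1 - g 0 0) = B * g 1 0 := by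
      linear_combination (A * g 0 0 + B * g 1 0 / 2) * hg - g 1 1 * h₁ + g 1 0 / 2 * h₂
    have e₂ : A * g 0 1 = -C * g 1 0 := by
      linear_combination g 1 1 / 2 * h₂ - g 1 0 * h₃ - (A * g 0 1 + B * g 1 1 / 2) * hg
    obtain ⟨v, hv⟩ : ∃ v, g 1 0 = 2 * A * v := ⟨g 1 0 / (2 * A), by field_simp⟩
    obtain ⟨u, hu⟩ : ∃ u, g 0 0 = u - B * v := ⟨g 0 0 + B * v, by ring⟩
    have hd : g 1 1 = u + B * v :=
      mul_left_cancel₀ hA (by linear_combination e₁ + A * hu + B * hv)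
    have hb : g 0 1 = -2 * C * v := mul_left_cancel₀ hA (by linear_combination e₂ - C * hv)
    have hg' : g = !![u - B * v, -2 * C * v; 2 * A * v, u + B * v] := by
      rw [← hu, ← hb, ← hv, ← hd]
      exact Matrix.eta_fin_two g
    rw [hu, hb, hv, hd] at hg
    have huv : u ^ 2 - (B ^ 2 - 4 * A * C) * v ^ 2 = 1 := by linear_combination hg
    have hu0 : u ≠ 0 := by
      rintro rfl
      nlinarith [mul_nonneg hD.le (sq_nonneg v)]
    rcases hu0.lt_or_gt with hneg | hpos
    · obtain ⟨t, ht⟩ := exists_Mt_eq (v := -v) hD (by simpa using huv) (neg_pos.2 hneg)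
      refine ⟨t, Or.inr ?_⟩
      rw [ht, hg']
      ext i j
      fin_cases i <;> fin_cases j <;> simp <;> ring
    · obtain ⟨t, ht⟩ := exists_Mt_eq hD huv hpos
      exact ⟨t, Or.inl (hg'.trans ht.symm)⟩
  · rintro ⟨t, rfl | rfl⟩
    · exact Qslash_Mt A B C t hD
    · simpa only [Matrix.neg_apply, Qslash_neg] using Qslash_Mt A B C t hD
end
end

section
/- Let Q=[A,B,C] be a real binary quadratic form with A≠0 and discriminant D=B²−4AC>0, with roots x>x', and let z_t := (x·e^t + x'·e^{−t})/(e^t+e^{−t}) + i·(x−x')/(e^t+e^{−t}). Then for every t∈ℝ, the map t↦z_t is differentiable with derivative (d/dt)z_t = −sign(A)·Q(z_t)/√D; equivalently, along the parametrization of C_Q, −√D·dz/Q(z) = sign(A)·dt. -/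
open Complex

noncomputable section

/-- The arclength parametrization of the upper half of the circle `C_Q`
joining the roots `x' < x`:
`z_t = (x eᵗ + x' e⁻ᵗ)/(eᵗ + e⁻ᵗ) + i (x − x')/(eᵗ + e⁻ᵗ)`. -/
def zparam (x x' t : ℝ) : ℂ :=
  (((x * Real.exp t + x' * Real.exp (-t)) / (Real.exp t + Real.exp (-t)) : ℝ) : ℂ) +
    (((x - x') / (Real.exp t + Real.exp (-t)) : ℝ) : ℂ) * Complex.I

/-- The derivative of `z_t` in closed form. -/
lemma hasDerivAt_zparam (x x' t : ℝ) :
    HasDerivAt (fun u : ℝ => zparam x x' u)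
      (((x - x' : ℝ) : ℂ) *
        (2 - ((Real.exp t - Real.exp (-t) : ℝ) : ℂ) * Complex.I) /
        ((Real.exp t + Real.exp (-t) : ℝ) : ℂ) ^ 2) t := by
  have hs : Real.exp t + Real.exp (-t) ≠ 0 := by positivity
  have hpq : Real.exp t * Real.exp (-t) = 1 := by rw [← Real.exp_add]; simp
  have hp := Real.hasDerivAt_exp t
  have hq : HasDerivAt (fun u : ℝ => Real.exp (-u)) (-Real.exp (-t)) t := by
    simpa using (hasDerivAt_neg t).exp
  have hre : HasDerivAt (fun u : ℝ => (x * Real.exp u + x' * Real.exp (-u)) /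
      (Real.exp u + Real.exp (-u)))
      ((x - x') * 2 / (Real.exp t + Real.exp (-t)) ^ 2) t := by
    refine (((hp.const_mul x).add (hq.const_mul x')).div (hp.add hq) hs).congr_deriv ?_
    simp only [Pi.add_apply]
    congr 1
    linear_combination 2 * (x - x') * hpq
  have him : HasDerivAt (fun u : ℝ => (x - x') / (Real.exp u + Real.exp (-u)))
      (-(x - x') * (Real.exp t - Real.exp (-t)) / (Real.exp t + Real.exp (-t)) ^ 2) t := by
    refine ((hasDerivAt_const t (x - x')).div (hp.add hq) hs).congr_deriv ?_
    simp only [Pi.add_apply]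
    congr 1
    ring
  refine (hre.ofReal_comp.add (him.ofReal_comp.mul_const Complex.I)).congr_deriv ?_
  push_cast
  ring

/-- The product `(z_t - x) (z_t - x')` in closed form. -/
lemma zparam_sub_mul_zparam_sub (x x' t : ℝ) :
    (zparam x x' t - x) * (zparam x x' t - x') =
      -((x - x' : ℝ) : ℂ) ^ 2 *
        (2 - ((Real.exp t - Real.exp (-t) : ℝ) : ℂ) * Complex.I) /
        ((Real.exp t + Real.exp (-t) : ℝ) : ℂ) ^ 2 := by
  have hs : ((Real.exp t + Real.exp (-t) : ℝ) : ℂ) ≠ 0 := by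
    exact_mod_cast (by positivity : Real.exp t + Real.exp (-t) ≠ 0)
  have hpq : ((Real.exp t : ℝ) : ℂ) * ((Real.exp (-t) : ℝ) : ℂ) = 1 := by
    rw [← Complex.ofReal_mul, ← Real.exp_add]; simp
  unfold zparam
  simp only [Complex.ofReal_add, Complex.ofReal_sub, Complex.ofReal_mul,
    Complex.ofReal_div] at hs ⊢
  generalize ((Real.exp t : ℝ) : ℂ) = p at *
  generalize ((Real.exp (-t) : ℝ) : ℂ) = q at *
  field_simp
  linear_combination ((x : ℂ) - x') ^ 2 * Complex.I_sq - ((x : ℂ) - x') ^ 2 * hpq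

/-- Let `Q = [A,B,C]` be a real quadratic form with `A ≠ 0`
and discriminant `D = B² − 4AC > 0`, with roots `x > x'`.  Then the
parametrization `t ↦ z_t` of `C_Q` is differentiable with
`(d/dt) z_t = −sign(A)·Q(z_t)/√D`; equivalently, along `C_Q` one has
`−√D·dz/Q(z) = sign(A)·dt`. -/
theorem zparam_hasDerivAt (A B C x x' : ℝ)
    (hA : A ≠ 0) (hD : 0 < B ^ 2 - 4 * A * C) (hlt : x' < x)
    (hx : A * x ^ 2 + B * x + C = 0) (hx' : A * x' ^ 2 + B * x' + C = 0) :
    ∀ t : ℝ, HasDerivAt (fun u : ℝ => zparam x x' u)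
      (-((Real.sign A : ℝ) : ℂ) * Qpoly (A, B, C) (zparam x x' t) /
        ((Real.sqrt (B ^ 2 - 4 * A * C) : ℝ) : ℂ)) t := by
  intro t
  have hne : x - x' ≠ 0 := sub_ne_zero.mpr hlt.ne'
  have hB : B = -A * (x + x') := mul_left_cancel₀ hne (by linear_combination hx - hx')
  have hC : C = A * x * x' := by rw [hB] at hx; linear_combination hx
  have hsqrt : Real.sqrt (B ^ 2 - 4 * A * C) = |A| * (x - x') := by
    rw [hB, hC, show (-A * (x + x')) ^ 2 - 4 * A * (A * x * x') = (A * (x - x')) ^ 2 by ring,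
      Real.sqrt_sq_eq_abs, abs_mul, abs_of_pos (sub_pos.mpr hlt)]
  have hQ : Qpoly (A, B, C) (zparam x x' t) =
      A * ((zparam x x' t - x) * (zparam x x' t - x')) := by
    simp only [Qpoly, hB, hC]
    push_cast
    ring
  have hsign : Real.sign A * A = |A| := by
    rcases hA.lt_or_gt with h | h
    · simp [Real.sign_of_neg h, abs_of_neg h]
    · simp [Real.sign_of_pos h, abs_of_pos h]
  have hsignC : ((Real.sign A : ℝ) : ℂ) * A = ((|A| : ℝ) : ℂ) := by exact_mod_cast hsign
  have habs : ((|A| : ℝ) : ℂ) ≠ 0 := by exact_mod_cast abs_ne_zero.mpr hA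
  have hneC : ((x - x' : ℝ) : ℂ) ≠ 0 := by exact_mod_cast hne
  refine (hasDerivAt_zparam x x' t).congr_deriv ?_
  rw [hQ, ← mul_assoc, neg_mul, hsignC, zparam_sub_mul_zparam_sub, hsqrt, Complex.ofReal_mul,
    eq_div_iff (mul_ne_zero habs hneC)]
  ring
end
end
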